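/- Let p and q be odd primes with p ≡ −1 (mod q), and let F ∈ GL₂(ℤ/p) be a matrix of multiplicative order q whose characteristic polynomial is irreducible over ℤ/p. On the set B = (ℤ/p × ℤ/p) × ℤ/q with componentwise addition +, define (v, x₃) ∘ (w, y₃) = (v + F^{x₃}·w, x₃ + y₃), where v,w ∈ ℤ/p × ℤ/p are column vectors. Then (B,+,∘) is a left brace, the kernel of λ has order p², and (B,∘) is isomorphic to the semidirect product (ℤ/p × ℤ/p) ⋊ ℤ/q in which the generator 1 of ℤ/q acts by F. Moreover, up to brace isomorphism it is the unique left brace with additive group ℤ/p × ℤ/p × ℤ/q whose kernel of λ has order p². -/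

import Mathlib

/-- `f` is a left-brace multiplication on the abelian group `B`: `(B, f)` is a group
with identity `0` and `f a (b + c) = f a b - a + f a c` holds. -/
def IsLeftBrace {B : Type*} [AddCommGroup B] (f : B → B → B) : Prop :=
  (∀ a b c, f (f a b) c = f a (f b c)) ∧
  (∀ a, f 0 a = a) ∧
  (∀ a, f a 0 = a) ∧
  (∀ a, ∃ a', f a' a = 0) ∧
  (∀ a b c, f a (b + c) = f a b - a + f a c)

/-- The kernel of `λ`: the set of `a` with `λ_a = id`, i.e. `a ∘ b = a + b` for all `b`. -/
def kerLambda {B : Type*} [AddCommGroup B] (f : B → B → B) : Set B :=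
  {a | ∀ b, f a b = a + b}

/-- The circle operation `(v, x₃) ∘ (w, y₃) = (v + F^{x₃} w, x₃ + y₃)` on
`(ℤ/p × ℤ/p) × ℤ/q`, for `F ∈ GL₂(ℤ/p)`. -/
def circ13 (p q : ℕ) (F : Matrix.GeneralLinearGroup (Fin 2) (ZMod p)) :
    (Fin 2 → ZMod p) × ZMod q → (Fin 2 → ZMod p) × ZMod q → (Fin 2 → ZMod p) × ZMod q :=
  fun x y =>
    (x.1 + Matrix.mulVec
        ((F ^ (x.2).val : Matrix.GeneralLinearGroup (Fin 2) (ZMod p)) :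
          Matrix (Fin 2) (Fin 2) (ZMod p)) y.1,
      x.2 + y.2)

theorem Matrix.exists_companion_conj {K : Type*} [Field K] (A : Matrix (Fin 2) (Fin 2) K)
    (hA : ∀ c : K, A ≠ Matrix.scalar (Fin 2) c) :
    ∃ P : Matrix (Fin 2) (Fin 2) K, P.det ≠ 0 ∧ A * P = P * !![0, -A.det; 1, A.trace] := by
  have key : ∀ v : Fin 2 → K, A * !![v 0, (A.mulVec v) 0; v 1, (A.mulVec v) 1] =
      !![v 0, (A.mulVec v) 0; v 1, (A.mulVec v) 1] * !![0, -A.det; 1, A.trace] := by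
    intro v
    ext i j
    fin_cases i <;> fin_cases j <;>
      simp [Matrix.mul_apply, Fin.sum_univ_two, Matrix.mulVec, dotProduct, Matrix.det_fin_two,
        Matrix.trace_fin_two] <;> ring
  by_contra! hcon
  have hdet : ∀ v : Fin 2 → K, v 0 * (A.mulVec v) 1 - (A.mulVec v) 0 * v 1 = 0 := by
    intro v
    by_contra hv
    exact hcon _ (by simpa [Matrix.det_fin_two] using hv) (key v)
  have h1 := hdet ![1, 0]
  have h2 := hdet ![0, 1]
  have h3 := hdet ![1, 1]
  simp [Matrix.mulVec, dotProduct, Fin.sum_univ_two] at h1 h2 h3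
  apply hA (A 0 0)
  ext i j
  fin_cases i <;> fin_cases j <;> simp [h1, h2]
  rw [h1, h2] at h3
  linear_combination h3

/-- Two non-scalar `2 × 2` matrices over a field with the same trace and determinant are
conjugate. -/
theorem Matrix.exists_conj_of_trace_eq_of_det_eq {K : Type*} [Field K]
    {A B : Matrix (Fin 2) (Fin 2) K}
    (hA : ∀ c : K, A ≠ Matrix.scalar (Fin 2) c) (hB : ∀ c : K, B ≠ Matrix.scalar (Fin 2) c)
    (htr : A.trace = B.trace) (hdet : A.det = B.det) :
    ∃ P : Matrix.GeneralLinearGroup (Fin 2) K,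
      (P : Matrix (Fin 2) (Fin 2) K) * A = B * (P : Matrix (Fin 2) (Fin 2) K) := by
  obtain ⟨P, hP, hAP⟩ := Matrix.exists_companion_conj A hA
  obtain ⟨Q, hQ, hBQ⟩ := Matrix.exists_companion_conj B hB
  let P' := Matrix.GeneralLinearGroup.mkOfDetNeZero P hP
  let Q' := Matrix.GeneralLinearGroup.mkOfDetNeZero Q hQ
  refine ⟨Q' * P'⁻¹, ?_⟩
  have h1 : A * (P' : Matrix (Fin 2) (Fin 2) K) = P' * !![0, -A.det; 1, A.trace] := hAP
  have h2 : B * (Q' : Matrix (Fin 2) (Fin 2) K) = Q' * !![0, -A.det; 1, A.trace] := by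
    rw [htr, hdet]; exact hBQ
  rw [Units.val_mul, ← mul_assoc, h2, mul_assoc, mul_assoc]
  congr 1
  rw [Units.inv_mul_eq_iff_eq_mul, ← mul_assoc, ← h1, mul_assoc, Units.mul_inv, mul_one]

/-- An eigenvalue of a `2 × 2` matrix of determinant one, with its inverse, sums to the trace. -/
theorem Matrix.trace_eq_add_inv_of_mulVec_eq {L : Type*} [Field L]
    {A : Matrix (Fin 2) (Fin 2) L} (hdet : A.det = 1) {u : L} (hu : u ≠ 0) {v : Fin 2 → L}
    (hv : v ≠ 0) (hAv : A.mulVec v = u • v) : A.trace = u + u⁻¹ := by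
  have h : (Matrix.scalar (Fin 2) u - A).det = 0 := by
    rw [← Matrix.exists_mulVec_eq_zero_iff]
    exact ⟨v, hv, by
      rw [Matrix.sub_mulVec, hAv, Matrix.scalar_apply, ← Matrix.smul_one_eq_diagonal,
        Matrix.smul_mulVec, Matrix.one_mulVec, sub_self]⟩
  rw [Matrix.det_fin_two] at h hdet
  simp at h
  rw [Matrix.trace_fin_two]
  field_simp
  linear_combination (-1 : L) * h + hdet

theorem Matrix.exists_eigenvector {L : Type*} [Field L] [IsAlgClosed L]
    (A : Matrix (Fin 2) (Fin 2) L) : ∃ (u : L) (v : Fin 2 → L), v ≠ 0 ∧ A.mulVec v = u • v := by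
  obtain ⟨u, hu⟩ := Module.End.exists_eigenvalue (Matrix.toLin' A)
  obtain ⟨v, hv⟩ := hu.exists_hasEigenvector
  exact ⟨u, v, hv.2, by simpa using hv.apply_eq_smul⟩

theorem Matrix.pow_mulVec_of_mulVec_eq_smul {L n : Type*} [Field L] [Fintype n] [DecidableEq n]
    {A : Matrix n n L} {u : L} {v : n → L} (h : A.mulVec v = u • v) (k : ℕ) :
    (A ^ k).mulVec v = u ^ k • v := by
  induction k with
  | zero => simp
  | succ k ih =>
    rw [pow_succ, ← Matrix.mulVec_mulVec, h, Matrix.mulVec_smul, ih, smul_smul, pow_succ']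

section PrimeOrder

variable {p q : ℕ} [Fact p.Prime] [Fact q.Prime]

theorem coprime_of_cast_eq_neg_one (hmod : (p : ZMod q) = -1) : Nat.Coprime p q := by
  rw [Nat.coprime_primes Fact.out Fact.out]
  rintro rfl
  simp at hmod

theorem det_eq_one_of_pow_eq_one (hq : Odd q) (hmod : (p : ZMod q) = -1)
    {M : Matrix (Fin 2) (Fin 2) (ZMod p)} (hM : M ^ q = 1) : M.det = 1 := by
  have hdq : M.det ^ q = 1 := by rw [← Matrix.det_pow, hM, Matrix.det_one]
  have hd0 : M.det ≠ 0 := by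
    intro h
    rw [h, zero_pow (Fact.out : q.Prime).ne_zero] at hdq
    exact zero_ne_one hdq
  have hdp := ZMod.pow_card_sub_one_eq_one hd0
  have hcop : Nat.Coprime q (p - 1) := by
    rw [(Fact.out : q.Prime).coprime_iff_not_dvd, ← ZMod.natCast_eq_zero_iff,
      Nat.cast_sub (Fact.out : p.Prime).one_le, hmod]
    intro h
    have h2 : ((2 : ℕ) : ZMod q) = 0 := by push_cast at h ⊢; linear_combination -h
    rw [ZMod.natCast_eq_zero_iff, Nat.prime_dvd_prime_iff_eq Fact.out Nat.prime_two] at h2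
    subst h2
    exact absurd hq (by decide)
  have := pow_gcd_eq_one.2 ⟨hdq, hdp⟩
  rwa [hcop, pow_one] at this

theorem trace_ne_two_of_pow_eq_one (hq : Odd q) (hmod : (p : ZMod q) = -1)
    {M : Matrix (Fin 2) (Fin 2) (ZMod p)} (hM : M ^ q = 1) (h1 : M ≠ 1) : M.trace ≠ 2 := by
  intro ht
  have hd := det_eq_one_of_pow_eq_one hq hmod hM
  have hsq : (M - 1) ^ 2 = 0 := by
    rw [Matrix.det_fin_two] at hd
    rw [Matrix.trace_fin_two] at ht
    ext i j
    fin_cases i <;> fin_cases j <;>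
      simp [pow_two, Matrix.mul_apply, Fin.sum_univ_two]
    · linear_combination M 0 0 * ht - hd
    · linear_combination M 0 1 * ht
    · linear_combination M 1 0 * ht
    · linear_combination M 1 1 * ht - hd
  have hpp : M ^ p = 1 := by
    have h := sub_pow_char_of_commute p (Commute.one_right M)
    rw [pow_eq_zero_of_le (Fact.out : p.Prime).two_le hsq, one_pow] at h
    exact (sub_eq_zero.1 h.symm)
  have := pow_gcd_eq_one.2 ⟨hpp, hM⟩
  rw [coprime_of_cast_eq_neg_one hmod, pow_one] at this
  exact h1 this

theorem ne_scalar_of_pow_eq_one (hq : Odd q) (hmod : (p : ZMod q) = -1)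
    {M : Matrix (Fin 2) (Fin 2) (ZMod p)} (hM : M ^ q = 1) (h1 : M ≠ 1) (c : ZMod p) :
    M ≠ Matrix.scalar (Fin 2) c := by
  intro hc
  have hd := det_eq_one_of_pow_eq_one hq hmod hM
  have h2 : M ^ 2 = 1 := by
    rw [hc, Matrix.det_fin_two] at hd
    rw [hc, ← map_pow, show c ^ 2 = 1 by simpa [pow_two] using hd, map_one]
  have := pow_gcd_eq_one.2 ⟨h2, hM⟩
  rw [(Nat.coprime_two_left).2 hq, pow_one] at this
  exact h1 this

/-- If `p ≡ -1 (mod q)` and `A`, `B` have order `q` in `GL₂(ℤ/p)`, then `A` is conjugate to a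
nontrivial power of `B`. -/
theorem exists_conj_pow_of_pow_eq_one (hq : Odd q) (hmod : (p : ZMod q) = -1)
    {A B : Matrix (Fin 2) (Fin 2) (ZMod p)} (hA : A ^ q = 1) (hA1 : A ≠ 1) (hB : B ^ q = 1)
    (hB1 : B ≠ 1) :
    ∃ k : ℕ, (k : ZMod q) ≠ 0 ∧ ∃ P : Matrix.GeneralLinearGroup (Fin 2) (ZMod p),
      (P : Matrix (Fin 2) (Fin 2) (ZMod p)) * A = B ^ k * P := by
  let L := AlgebraicClosure (ZMod p)
  let φ : Matrix (Fin 2) (Fin 2) (ZMod p) →+* Matrix (Fin 2) (Fin 2) L :=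
    (algebraMap (ZMod p) L).mapMatrix
  have hφdet : ∀ M : Matrix (Fin 2) (Fin 2) (ZMod p), M ^ q = 1 → (φ M).det = 1 := by
    intro M hM
    rw [← RingHom.map_det, det_eq_one_of_pow_eq_one hq hmod hM, map_one]
  have hφtr : ∀ M : Matrix (Fin 2) (Fin 2) (ZMod p),
      (φ M).trace = algebraMap (ZMod p) L M.trace := by
    intro M
    simp [φ, Matrix.trace_fin_two]
  have heig : ∀ M : Matrix (Fin 2) (Fin 2) (ZMod p), M ^ q = 1 → M ≠ 1 →
      ∃ (u : L) (v : Fin 2 → L), v ≠ 0 ∧ (φ M).mulVec v = u • v ∧ u ^ q = 1 ∧ u ≠ 1 := by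
    intro M hM hM1
    obtain ⟨u, v, hv, huv⟩ := Matrix.exists_eigenvector (φ M)
    refine ⟨u, v, hv, huv, ?_, ?_⟩
    · have h := Matrix.pow_mulVec_of_mulVec_eq_smul huv q
      rw [← map_pow, hM, map_one, Matrix.one_mulVec] at h
      have h' : (u ^ q - 1) • v = 0 := by rw [sub_smul, ← h, one_smul, sub_self]
      exact sub_eq_zero.1 ((smul_eq_zero.1 h').resolve_right hv)
    · rintro rfl
      have h := Matrix.trace_eq_add_inv_of_mulVec_eq (hφdet M hM) one_ne_zero hv huv
      rw [hφtr, inv_one, one_add_one_eq_two, ← map_ofNat (algebraMap (ZMod p) L) 2] at h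
      exact trace_ne_two_of_pow_eq_one hq hmod hM hM1 ((algebraMap (ZMod p) L).injective h)
  obtain ⟨u, v, hv, huv, huq, hu1⟩ := heig A hA hA1
  obtain ⟨w, z, hz, hwz, hwq, hw1⟩ := heig B hB hB1
  have hprim : IsPrimitiveRoot w q := by
    rw [← orderOf_eq_prime hwq hw1]
    exact IsPrimitiveRoot.orderOf w
  obtain ⟨k, -, rfl⟩ := hprim.eq_pow_of_pow_eq_one huq
  have hk : (k : ZMod q) ≠ 0 := by
    intro hk
    rw [ZMod.natCast_eq_zero_iff] at hk
    exact hu1 ((hprim.pow_eq_one_iff_dvd k).2 hk)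
  have hBkq : (B ^ k) ^ q = 1 := by rw [← pow_mul, mul_comm, pow_mul, hB, one_pow]
  have hBk1 : B ^ k ≠ 1 := by
    intro h
    have h' := pow_gcd_eq_one.2 ⟨h, hB⟩
    have hcop : k.Coprime q := by
      rw [Nat.coprime_comm, (Fact.out : q.Prime).coprime_iff_not_dvd, ← ZMod.natCast_eq_zero_iff]
      exact hk
    rw [hcop, pow_one] at h'
    exact hB1 h'
  have hw0 : w ^ k ≠ 0 := by
    intro h
    rw [h, zero_pow (Fact.out : q.Prime).ne_zero] at huq
    exact zero_ne_one huq
  refine ⟨k, hk, Matrix.exists_conj_of_trace_eq_of_det_eq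
    (ne_scalar_of_pow_eq_one hq hmod hA hA1) (ne_scalar_of_pow_eq_one hq hmod hBkq hBk1) ?_ ?_⟩
  · apply (algebraMap (ZMod p) L).injective
    rw [← hφtr, ← hφtr, Matrix.trace_eq_add_inv_of_mulVec_eq (hφdet A hA) hw0 hv huv,
      Matrix.trace_eq_add_inv_of_mulVec_eq (hφdet _ hBkq) hw0 hz
        (by rw [map_pow]; exact Matrix.pow_mulVec_of_mulVec_eq_smul hwz k)]
  · rw [det_eq_one_of_pow_eq_one hq hmod hA, det_eq_one_of_pow_eq_one hq hmod hBkq]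

end PrimeOrder

namespace IsLeftBrace

variable {B : Type*} [AddCommGroup B] {f : B → B → B}

theorem assoc (hf : IsLeftBrace f) (a b c : B) : f (f a b) c = f a (f b c) := hf.1 a b c

theorem zero_circ (hf : IsLeftBrace f) (a : B) : f 0 a = a := hf.2.1 a

theorem circ_zero (hf : IsLeftBrace f) (a : B) : f a 0 = a := hf.2.2.1 a

theorem circ_add (hf : IsLeftBrace f) (a b c : B) : f a (b + c) = f a b - a + f a c :=
  hf.2.2.2.2 a b c

theorem exists_right_inverse (hf : IsLeftBrace f) (a : B) : ∃ a', f a a' = 0 := by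
  obtain ⟨a', ha'⟩ := hf.2.2.2.1 a
  obtain ⟨a'', ha''⟩ := hf.2.2.2.1 a'
  refine ⟨a', ?_⟩
  have h : a'' = a := by
    rw [← hf.circ_zero a'', ← ha', ← hf.assoc, ha'', hf.zero_circ]
  rwa [h] at ha''

theorem eq_zero_of_circ_eq_self (hf : IsLeftBrace f) {a b : B} (h : f a b = b) : a = 0 := by
  obtain ⟨b', hb'⟩ := hf.exists_right_inverse b
  rw [← hf.circ_zero a, ← hb', ← hf.assoc, h]

/-- The map `λ_a : b ↦ -a + a ∘ b` as an additive endomorphism. -/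
def lam (hf : IsLeftBrace f) (a : B) : B →+ B :=
  AddMonoidHom.mk' (fun b => -a + f a b) fun b c => by rw [hf.circ_add]; abel

theorem circ_eq (hf : IsLeftBrace f) (a b : B) : f a b = a + hf.lam a b := by
  simp [lam]

theorem mem_kerLambda_iff (hf : IsLeftBrace f) {a : B} : a ∈ kerLambda f ↔ hf.lam a = .id B := by
  simp [kerLambda, DFunLike.ext_iff, hf.circ_eq]

theorem lam_circ (hf : IsLeftBrace f) (a b : B) :
    hf.lam (f a b) = (hf.lam a).comp (hf.lam b) := by
  ext c
  have h := hf.assoc a b c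
  rw [hf.circ_eq (f a b), hf.circ_eq a (f b c), hf.circ_eq a b, hf.circ_eq b c, map_add,
    ← add_assoc] at h
  simpa [hf.circ_eq a b] using h

theorem lam_zero (hf : IsLeftBrace f) : hf.lam 0 = .id B := by
  ext c
  simp [lam, hf.zero_circ]

/-- The kernel of `λ` as a subgroup of the additive group. -/
def ker (hf : IsLeftBrace f) : AddSubgroup B where
  carrier := kerLambda f
  zero_mem' := hf.mem_kerLambda_iff.2 hf.lam_zero
  add_mem' {a b} ha hb := by
    rw [← ha b, hf.mem_kerLambda_iff, hf.lam_circ, hf.mem_kerLambda_iff.1 ha,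
      hf.mem_kerLambda_iff.1 hb, AddMonoidHom.id_comp]
  neg_mem' {a} ha := by
    have h := hf.lam_circ a (-a)
    rw [ha, add_neg_cancel, hf.lam_zero, hf.mem_kerLambda_iff.1 ha, AddMonoidHom.id_comp] at h
    exact hf.mem_kerLambda_iff.2 h.symm

end IsLeftBrace

section PowVal

variable {M : Type*} [Monoid M] {q : ℕ} {g : M}

theorem pow_zmod_val_add [NeZero q] (hg : g ^ q = 1) (x y : ZMod q) :
    g ^ (x + y).val = g ^ x.val * g ^ y.val := by
  rw [ZMod.val_add, ← pow_eq_pow_mod _ hg, pow_add]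

theorem pow_zmod_val_mul (hg : g ^ q = 1) (x y : ZMod q) :
    g ^ (x * y).val = (g ^ x.val) ^ y.val := by
  rw [ZMod.val_mul, ← pow_eq_pow_mod _ hg, pow_mul]

theorem pow_zmod_val_natCast (hg : g ^ q = 1) (k : ℕ) : g ^ (k : ZMod q).val = g ^ k := by
  rw [ZMod.val_natCast, ← pow_eq_pow_mod _ hg]

end PowVal

section Circ

variable {p q : ℕ} [Fact p.Prime] [Fact q.Prime]

theorem isLeftBrace_circ13 {F : Matrix.GeneralLinearGroup (Fin 2) (ZMod p)} (hF : F ^ q = 1) :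
    IsLeftBrace (circ13 p q F) := by
  refine ⟨fun a b c => ?_, fun a => ?_, fun a => ?_, fun a => ?_, fun a b c => ?_⟩
  · simp [circ13, pow_zmod_val_add hF, Matrix.mulVec_add, add_assoc, ← Matrix.mulVec_mulVec,
      -Matrix.mulVec_fin_two]
  · simp [circ13]
  · simp [circ13]
  · refine ⟨(-((F ^ (-a.2).val : Matrix.GeneralLinearGroup (Fin 2) (ZMod p)) :
          Matrix (Fin 2) (Fin 2) (ZMod p)).mulVec a.1, -a.2), ?_⟩
    simp [circ13]
  · simp only [circ13]
    ext1
    · simp [Matrix.mulVec_add, add_left_comm, -Matrix.mulVec_fin_two]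
    · simp [add_left_comm]

theorem kerLambda_circ13 {F : Matrix.GeneralLinearGroup (Fin 2) (ZMod p)} (hF : orderOf F = q) :
    kerLambda (circ13 p q F) = {a | a.2 = 0} := by
  ext a
  constructor
  · intro ha
    have h : ((F ^ a.2.val : Matrix.GeneralLinearGroup (Fin 2) (ZMod p)) :
        Matrix (Fin 2) (Fin 2) (ZMod p)) = 1 := by
      rw [Matrix.ext_iff_mulVec]
      intro v
      simpa [circ13, -Matrix.mulVec_fin_two] using congrArg Prod.fst (ha (v, 0))
    rw [← Units.val_one, Units.val_inj, ← orderOf_dvd_iff_pow_eq_one, hF] at h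
    exact (ZMod.val_eq_zero _).1 (Nat.eq_zero_of_dvd_of_lt h (ZMod.val_lt _))
  · rintro (ha : a.2 = 0) b
    simp [circ13, ha, Prod.add_def]

theorem ncard_snd_eq_zero (p q : ℕ) [Fact p.Prime] [Fact q.Prime] :
    {a : (Fin 2 → ZMod p) × ZMod q | a.2 = 0}.ncard = p ^ 2 := by
  have h : {a : (Fin 2 → ZMod p) × ZMod q | a.2 = 0} = Set.univ ×ˢ {0} := by
    ext a
    simp
  rw [h, Set.ncard_prod]
  simp [Set.ncard_univ]

theorem addMonoidHom_eq_zero_of_coprime (hpq : p.Coprime q) {M N : Type*} [AddCommGroup M]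
    [AddCommGroup N] [Module (ZMod p) M] [Module (ZMod q) N] (g : M →+ N) : g = 0 := by
  ext v
  have h : (p : ZMod q) • g v = 0 := by
    rw [Nat.cast_smul_eq_nsmul, ← map_nsmul, ← Nat.cast_smul_eq_nsmul (ZMod p)]
    simp
  have hp0 : (p : ZMod q) ≠ 0 := by
    rw [Ne, ZMod.natCast_eq_zero_iff, ← (Fact.out : q.Prime).coprime_iff_not_dvd]
    exact hpq.symm
  exact (smul_eq_zero.1 h).resolve_left hp0

theorem kerLambda_eq_of_card (hpq : p.Coprime q)
    {h : (Fin 2 → ZMod p) × ZMod q → (Fin 2 → ZMod p) × ZMod q → (Fin 2 → ZMod p) × ZMod q}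
    (hh : IsLeftBrace h) (hcard : Nat.card ↥(kerLambda h) = p ^ 2) :
    kerLambda h = {a | a.2 = 0} := by
  apply Set.eq_of_subset_of_ncard_le
  · intro a ha
    have hz : Nat.card hh.ker • (⟨a, ha⟩ : hh.ker) = 0 := card_nsmul_eq_zero'
    have hz' : p ^ 2 • a = 0 := by
      rw [← hcard]
      exact congrArg Subtype.val hz
    have h2 : ((p ^ 2 : ℕ) : ZMod q) * a.2 = 0 := by
      rw [← nsmul_eq_mul]
      exact congrArg Prod.snd hz'
    refine (mul_eq_zero.1 h2).resolve_left ?_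
    rw [ZMod.natCast_eq_zero_iff, ← (Fact.out : q.Prime).coprime_iff_not_dvd]
    exact (hpq.pow_left 2).symm
  · rw [ncard_snd_eq_zero, ← hcard]
    rfl
  · exact Set.toFinite _

theorem exists_matrix_of_card_kerLambda (hpq : p.Coprime q)
    {h : (Fin 2 → ZMod p) × ZMod q → (Fin 2 → ZMod p) × ZMod q → (Fin 2 → ZMod p) × ZMod q}
    (hh : IsLeftBrace h) (hcard : Nat.card ↥(kerLambda h) = p ^ 2) :
    ∃ M : Matrix (Fin 2) (Fin 2) (ZMod p), M ^ q = 1 ∧ M ≠ 1 ∧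
      ∀ a b, h a b = (a.1 + (M ^ a.2.val).mulVec b.1, a.2 + b.2) := by
  have hker := kerLambda_eq_of_card hpq hh hcard
  have hmem : ∀ v, (v, 0) ∈ kerLambda h := fun v => by rw [hker]; rfl
  have hlam : ∀ v x, hh.lam (v, x) = hh.lam (0, x) := by
    intro v x
    have h1 := hh.lam_circ (v, 0) (0, x)
    rw [hmem v, hh.mem_kerLambda_iff.1 (hmem v), AddMonoidHom.id_comp] at h1
    simpa using h1
  let α : ZMod q → Matrix (Fin 2) (Fin 2) (ZMod p) := fun x =>
    LinearMap.toMatrix' (AddMonoidHom.toZModLinearMap p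
      (((AddMonoidHom.fst _ _).comp (hh.lam (0, x))).comp (AddMonoidHom.inl _ _)))
  let β : ZMod q → ZMod q := fun x => (hh.lam (0, x) (0, 1)).2
  have hlam' : ∀ x w y, hh.lam (0, x) (w, y) = ((α x).mulVec w, β x * y) := by
    intro x w y
    have h1 : (hh.lam (0, x) (w, 0)).2 = 0 := DFunLike.congr_fun
      (addMonoidHom_eq_zero_of_coprime hpq
        (((AddMonoidHom.snd _ _).comp (hh.lam (0, x))).comp (AddMonoidHom.inl _ _))) w
    have h2 : (hh.lam (0, x) (0, y)).1 = 0 := DFunLike.congr_fun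
      (addMonoidHom_eq_zero_of_coprime hpq.symm
        (((AddMonoidHom.fst _ _).comp (hh.lam (0, x))).comp (AddMonoidHom.inr _ _))) y
    have h3 : (hh.lam (0, x) (w, 0)).1 = (α x).mulVec w := by
      rw [LinearMap.toMatrix'_mulVec]
      rfl
    have h4 : (hh.lam (0, x) (0, y)).2 = β x * y := by
      have := (AddMonoidHom.toZModLinearMap q
        (((AddMonoidHom.snd _ _).comp (hh.lam (0, x))).comp (AddMonoidHom.inr _ _))).map_smul y 1
      simp only [smul_eq_mul, mul_one] at this
      exact this.trans (mul_comm _ _)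
    have h5 : ((w, y) : (Fin 2 → ZMod p) × ZMod q) = (w, 0) + (0, y) := by simp
    rw [h5, map_add]
    ext1
    · rw [Prod.fst_add, h2, h3, add_zero]
    · rw [Prod.snd_add, h1, h4, zero_add]
  have hβ : ∀ x, β x = 1 := by
    intro x
    by_contra hx
    have hx' : 1 - β x ≠ 0 := sub_ne_zero.2 (Ne.symm hx)
    have hfix : h (0, x) (0, x / (1 - β x)) = (0, x / (1 - β x)) := by
      rw [hh.circ_eq, hlam']
      ext1
      · simp
      · simp only [Prod.mk_add_mk]
        field_simp
        ring
    have h0 : x = 0 := congrArg Prod.snd (hh.eq_zero_of_circ_eq_self hfix)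
    apply hx
    subst h0
    have : hh.lam (0, 0) = .id _ := hh.lam_zero
    simp [β, this]
  have hcirc : ∀ a b, h a b = (a.1 + (α a.2).mulVec b.1, a.2 + b.2) := by
    rintro ⟨v, x⟩ ⟨w, y⟩
    rw [hh.circ_eq, hlam, hlam', hβ, one_mul]
    rfl
  have hα0 : α 0 = 1 := by
    rw [Matrix.ext_iff_mulVec]
    intro v
    simpa [hcirc] using congrArg Prod.fst (hh.zero_circ (v, 0))
  have hαadd : ∀ x y, α (x + y) = α x * α y := by
    intro x y
    rw [Matrix.ext_iff_mulVec]
    intro v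
    simpa [hcirc, -Matrix.mulVec_fin_two] using congrArg Prod.fst (hh.assoc (0, x) (0, y) (v, 0))
  have hαn : ∀ n : ℕ, α n = α 1 ^ n := by
    intro n
    induction n with
    | zero => simpa using hα0
    | succ n ih => rw [Nat.cast_succ, hαadd, ih, pow_succ]
  refine ⟨α 1, ?_, ?_, fun a b => ?_⟩
  · rw [← hαn, ZMod.natCast_self, hα0]
  · intro h1
    have : ((0, 1) : (Fin 2 → ZMod p) × ZMod q) ∈ kerLambda h := by
      intro b
      simp [hcirc, h1, Prod.add_def]
    rw [hker] at this
    exact one_ne_zero this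
  · rw [← hαn, ZMod.natCast_zmod_val, hcirc]

theorem exists_equiv_circ13 {F : Matrix.GeneralLinearGroup (Fin 2) (ZMod p)} (hF : F ^ q = 1)
    {M : Matrix (Fin 2) (Fin 2) (ZMod p)} {k : ℕ} (hk : (k : ZMod q) ≠ 0)
    {P : Matrix.GeneralLinearGroup (Fin 2) (ZMod p)}
    (hP : (P : Matrix (Fin 2) (Fin 2) (ZMod p)) * M =
      (F : Matrix (Fin 2) (Fin 2) (ZMod p)) ^ k * P) :
    ∃ e : (Fin 2 → ZMod p) × ZMod q ≃ (Fin 2 → ZMod p) × ZMod q,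
      (∀ a b, e (a + b) = e a + e b) ∧
      ∀ a b, e (a.1 + (M ^ a.2.val).mulVec b.1, a.2 + b.2) = circ13 p q F (e a) (e b) := by
  let e₁ : (Fin 2 → ZMod p) ≃ (Fin 2 → ZMod p) :=
    { toFun := (P : Matrix (Fin 2) (Fin 2) (ZMod p)).mulVec
      invFun := ((P⁻¹ : Matrix.GeneralLinearGroup (Fin 2) (ZMod p)) :
        Matrix (Fin 2) (Fin 2) (ZMod p)).mulVec
      left_inv := fun v => by rw [Matrix.mulVec_mulVec, Units.inv_mul, Matrix.one_mulVec]
      right_inv := fun v => by rw [Matrix.mulVec_mulVec, Units.mul_inv, Matrix.one_mulVec] }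
  have hpow : ∀ n : ℕ, (P : Matrix (Fin 2) (Fin 2) (ZMod p)) * M ^ n =
      ((F : Matrix (Fin 2) (Fin 2) (ZMod p)) ^ k) ^ n * P :=
    fun n => SemiconjBy.pow_right (a := (P : Matrix (Fin 2) (Fin 2) (ZMod p))) hP n
  refine ⟨e₁.prodCongr (Equiv.mulLeft₀ (k : ZMod q) hk), fun a b => ?_, fun a b => ?_⟩
  · ext1
    · exact Matrix.mulVec_add (P : Matrix (Fin 2) (Fin 2) (ZMod p)) a.1 b.1
    · exact mul_add _ _ _
  · ext1
    · change (P : Matrix (Fin 2) (Fin 2) (ZMod p)).mulVec _ =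
        (P : Matrix (Fin 2) (Fin 2) (ZMod p)).mulVec _ + Matrix.mulVec
          ((F ^ ((k : ZMod q) * a.2).val : Matrix.GeneralLinearGroup (Fin 2) (ZMod p)) :
            Matrix (Fin 2) (Fin 2) (ZMod p)) ((P : Matrix (Fin 2) (Fin 2) (ZMod p)).mulVec _)
      rw [pow_zmod_val_mul hF, pow_zmod_val_natCast hF, Matrix.mulVec_add, Matrix.mulVec_mulVec,
        Matrix.mulVec_mulVec, hpow, Units.val_pow_eq_pow_val, Units.val_pow_eq_pow_val]
    · exact mul_add _ _ _

end Circ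

/-- Let `p, q` be odd primes with `p ≡ -1 (mod q)` and let `F ∈ GL₂(ℤ/p)` have order
`q` and irreducible characteristic polynomial.  On `B = (ℤ/p × ℤ/p) × ℤ/q` the
operation `(v,x₃) ∘ (w,y₃) = (v + F^{x₃} w, x₃ + y₃)` makes `(B,+,∘)` a left brace
with `|ker λ| = p²`; `(B,∘)` is isomorphic to `(ℤ/p × ℤ/p) ⋊ ℤ/q` where the generator
`1` of `ℤ/q` acts by `F`; and up to brace isomorphism it is the unique left brace
with additive group `ℤ/p × ℤ/p × ℤ/q` and `|ker λ| = p²`. -/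
theorem stmt_13 (p q : ℕ) (hp : p.Prime) (hq : q.Prime) (hpodd : Odd p)
    (hqodd : Odd q) (hmod : (p : ZMod q) = -1)
    (F : Matrix.GeneralLinearGroup (Fin 2) (ZMod p)) (hF : orderOf F = q)
    (hirr : Irreducible (Matrix.charpoly (F : Matrix (Fin 2) (Fin 2) (ZMod p)))) :
    IsLeftBrace (circ13 p q F) ∧
    Nat.card ↥(kerLambda (circ13 p q F)) = p ^ 2 ∧
    (∃ e : (Fin 2 → ZMod p) × ZMod q ≃ (Fin 2 → ZMod p) × ZMod q,
      ∀ a b, e (circ13 p q F a b) =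
        ((e a).1 + Matrix.mulVec
            ((F ^ ((e a).2).val : Matrix.GeneralLinearGroup (Fin 2) (ZMod p)) :
              Matrix (Fin 2) (Fin 2) (ZMod p)) (e b).1,
          (e a).2 + (e b).2)) ∧
    (∀ h : (Fin 2 → ZMod p) × ZMod q → (Fin 2 → ZMod p) × ZMod q →
        (Fin 2 → ZMod p) × ZMod q,
      IsLeftBrace h → Nat.card ↥(kerLambda h) = p ^ 2 →
      ∃ e : (Fin 2 → ZMod p) × ZMod q ≃ (Fin 2 → ZMod p) × ZMod q,
        (∀ a b, e (a + b) = e a + e b) ∧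
        ∀ a b, e (h a b) = circ13 p q F (e a) (e b)) := by
  have := Fact.mk hp
  have := Fact.mk hq
  have hFq : F ^ q = 1 := hF ▸ pow_orderOf_eq_one F
  have hF1 : F ≠ 1 := by
    rintro rfl
    exact hq.ne_one (hF ▸ orderOf_one)
  refine ⟨isLeftBrace_circ13 hFq, ?_, ⟨Equiv.refl _, fun a b => rfl⟩, fun h hh hcard => ?_⟩
  · rw [kerLambda_circ13 hF]
    exact ncard_snd_eq_zero p q
  · obtain ⟨M, hMq, hM1, hM⟩ :=
      exists_matrix_of_card_kerLambda (coprime_of_cast_eq_neg_one hmod) hh hcard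
    obtain ⟨k, hk, P, hP⟩ := exists_conj_pow_of_pow_eq_one hqodd hmod hMq hM1
      (B := (F : Matrix (Fin 2) (Fin 2) (ZMod p)))
      (by rw [← Units.val_pow_eq_pow_val, hFq, Units.val_one])
      (fun h1 => hF1 (Units.ext h1))
    obtain ⟨e, hadd, he⟩ := exists_equiv_circ13 hFq hk hP
    exact ⟨e, hadd, fun a b => by rw [hM, he]⟩
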